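/- (Specification Satisfaction) Let S_d = (X_d,T_d,L,Y_d,H) be a sampled transition system of a transition system S = (X,T,L,Y,H), where each label ℓ ∈ L is a positive real number, and let Ξ = {Ŷ₁,…,Ŷ_{N_y}} be a task site assignment with key state classes X̂_i (for those Ŷ_i with Ŷ_i ∩ Y_d ≠ ∅) and key transition classes T̂_j (for those Ŷ_j with Ŷ_j ∩ Y_d = ∅). Let M be the specification defined from Ξ, i.e., the set of execution trajectories of S_d containing at least one state of every key state class and at least one transition of every key transition class. If a trajectory τ ∈ Σ(S_d) satisfies M (i.e., τ ∈ M), then there exists an implementation ζ of τ whose output behavior ξ_ζ satisfies the task site assignment Ξ, i.e., Ŷ_i ∩ Im(ξ_ζ) ≠ ∅ for every i ∈ {1,…,N_y}. -/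

import Mathlib

open Finset in
/-- Partial sums of a sequence that is positive below `N` are strictly increasing up to `N`. -/
theorem strictMonoOn_sum_range_of_pos {N : ℕ} {ℓ : ℕ → ℝ} (hℓ : ∀ k < N, 0 < ℓ k) :
    StrictMonoOn (fun n => ∑ k ∈ range n, ℓ k) (Set.Iic N) := by
  intro a _ b hb hab
  refine sum_lt_sum_of_subset (range_subset_range.2 hab.le) (mem_range.2 hab) (by simp)
    (hℓ a (hab.trans_le hb)) fun j hj _ => (hℓ j ?_).le
  exact (mem_range.1 hj).trans_le hb

/-- A function can be prescribed at finitely many breakpoints `S 0 < ⋯ < S N` and, in addition, can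
be made to take finitely many prescribed values `w j`, each one inside a prescribed open interval
between consecutive breakpoints. -/
theorem exists_interpolation_with_values {X : Type*} {n N : ℕ} {S : ℕ → ℝ}
    (hS : StrictMonoOn S (Set.Iic N)) (x : ℕ → X) {p : Fin n → Prop} (m : Subtype p → ℕ)
    (hm : ∀ j, m j < N) (w : Subtype p → X) :
    ∃ ζ : ℝ → X, (∀ k ≤ N, ζ (S k) = x k) ∧
      ∀ j, ∃ γ ∈ Set.Ioo (S (m j)) (S (m j + 1)), ζ γ = w j := by
  set r : Subtype p → ℝ := fun j => ((j.1 : ℝ) + 1) / (n + 1)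
  have hr0 : ∀ j, 0 < r j := fun j => by positivity
  have hr1 : ∀ j, r j < 1 := fun j => by
    have : (j.1 : ℝ) < n := mod_cast j.1.2
    rw [div_lt_one (by positivity)]
    linarith
  have hrinj : Function.Injective r := fun i j h => by
    have hn : (n + 1 : ℝ) ≠ 0 := by positivity
    have h' : ((i.1 : ℕ) : ℝ) = (j.1 : ℕ) := add_right_cancel ((div_left_inj' hn).1 h)
    exact Subtype.ext (Fin.ext (mod_cast h'))
  have hstep : ∀ j, S (m j) < S (m j + 1) := fun j =>
    hS (hm j).le (Nat.succ_le_of_lt (hm j)) (Nat.lt_succ_self _)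
  set t : Subtype p → ℝ := fun j => S (m j) + r j * (S (m j + 1) - S (m j))
  have ht : ∀ j, t j ∈ Set.Ioo (S (m j)) (S (m j + 1)) := fun j => by
    have h := hstep j
    constructor <;> simp only [t] <;> nlinarith [hr0 j, hr1 j]
  have hle : ∀ j, ∀ k ≤ N, S k < t j → k ≤ m j := fun j k hk h => by
    by_contra! hlt
    exact absurd (hS.monotoneOn (Nat.succ_le_of_lt (hm j)) hk (Nat.succ_le_of_lt hlt))
      (not_le.2 (h.trans (ht j).2))
  have htinj : Function.Injective t := fun i j h => by
    have hmm : m i = m j := le_antisymm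
      (hle j _ (hm i).le (h ▸ (ht i).1)) (hle i _ (hm j).le (h ▸ (ht j).1))
    simp only [t, hmm] at h
    exact hrinj (mul_right_cancel₀ (sub_pos.2 (hstep j)).ne' (add_left_cancel h))
  have hSinj : Function.Injective fun k : Fin (N + 1) => S k := fun a b h =>
    Fin.ext (hS.injOn (Nat.le_of_lt_succ a.2) (Nat.le_of_lt_succ b.2) h)
  have hne : ∀ (k : Fin (N + 1)) (j : Subtype p), S k ≠ t j := fun k j h => by
    have hk : (k : ℕ) ≤ N := Nat.le_of_lt_succ k.2
    have hkm : m j < k := (hS.lt_iff_lt (hm j).le hk).1 (h ▸ (ht j).1)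
    exact absurd (hS.monotoneOn (Nat.succ_le_of_lt (hm j)) hk (Nat.succ_le_of_lt hkm))
      (not_le.2 (h ▸ (ht j).2))
  have hinj := hSinj.sumElim htinj hne
  refine ⟨Function.extend (Sum.elim (fun k : Fin (N + 1) => S k) t)
    (Sum.elim (fun k => x k) w) fun _ => x 0, fun k hk => ?_, fun j => ⟨t j, ht j, ?_⟩⟩
  · exact hinj.extend_apply _ _ (Sum.inl ⟨k, Nat.lt_succ_of_le hk⟩)
  · exact hinj.extend_apply _ _ (Sum.inr j)

/-- Specification Satisfaction: Let `S_d` be a sampled transition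
system of `S` (labels are positive reals), and `Ξ = {Yhat 1,…,Yhat Ny}` a task
site assignment, with key state classes for those `Yhat i` meeting `Y_d` and
key transition classes for the others.  If an execution trajectory `τ` of
`S_d` satisfies the specification `M` (it contains a state of every key state
class and a transition of every key transition class), then there exists an
implementation `ζ` of `τ` whose output behavior meets every `Yhat i`. -/
theorem specification_satisfaction
    {X Y : Type*} (T : Set (X × ℝ × X)) (H : X → Y)
    (hpos : ∀ t ∈ T, 0 < t.2.1)
    (Xd : Set X) (Td : Set (X × ℝ × X)) (Yd : Set Y)
    (hTd : Td = {t | t ∈ T ∧ t.1 ∈ Xd ∧ t.2.2 ∈ Xd})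
    (hYd : Yd = H '' Xd)
    (Ny : ℕ) (Yhat : Fin Ny → Set Y)
    (N : ℕ) (x : ℕ → X) (ℓ : ℕ → ℝ)
    (htraj : ∀ k < N, (x k, ℓ k, x (k + 1)) ∈ Td)
    -- τ contains a state of every key state class:
    (hkeystate : ∀ i, (Yhat i ∩ Yd).Nonempty →
      ∃ m ≤ N, x m ∈ Xd ∧ H (x m) ∈ Yhat i)
    -- τ contains a transition of every key transition class:
    (hkeytrans : ∀ i, Yhat i ∩ Yd = ∅ →
      ∃ m < N, (x m, ℓ m, x (m + 1)) ∈ Td ∧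
        ∃ ζ' : ℝ → X, ζ' 0 = x m ∧ ζ' (ℓ m) = x (m + 1) ∧
          ∃ γ ∈ Set.Ioo (0 : ℝ) (ℓ m), H (ζ' γ) ∈ Yhat i) :
    ∃ ζ : ℝ → X,
      (∀ m ≤ N, ζ (∑ k ∈ Finset.range m, ℓ k) = x m) ∧
      ∀ i, ∃ γ ∈ Set.Icc (0 : ℝ) (∑ k ∈ Finset.range N, ℓ k),
        H (ζ γ) ∈ Yhat i := by
  subst hTd
  have hmono := strictMonoOn_sum_range_of_pos fun k hk => hpos _ (htraj k hk).1
  have hbd : ∀ k ≤ N, ∑ i ∈ Finset.range k, ℓ i ∈ Set.Icc 0 (∑ i ∈ Finset.range N, ℓ i) :=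
    fun k hk => ⟨by simpa using hmono.monotoneOn (Nat.zero_le N) hk (Nat.zero_le k),
      hmono.monotoneOn hk Set.self_mem_Iic hk⟩
  have hvalue : ∀ i : {i // Yhat i ∩ Yd = ∅}, ∃ m < N, ∃ w, H w ∈ Yhat i := fun i => by
    obtain ⟨m, hm, -, ζ', -, -, γ, -, hγ⟩ := hkeytrans i i.2
    exact ⟨m, hm, ζ' γ, hγ⟩
  choose m hm w hw using hvalue
  obtain ⟨ζ, hζ, hζw⟩ := exists_interpolation_with_values hmono x m hm w
  refine ⟨ζ, hζ, fun i => ?_⟩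
  rcases Set.eq_empty_or_nonempty (Yhat i ∩ Yd) with h | h
  · obtain ⟨γ, hγ, hγw⟩ := hζw ⟨i, h⟩
    exact ⟨γ, ⟨(hbd _ (hm _).le).1.trans hγ.1.le,
      hγ.2.le.trans (hbd _ (Nat.succ_le_of_lt (hm _))).2⟩, hγw ▸ hw ⟨i, h⟩⟩
  · obtain ⟨k, hk, -, hHk⟩ := hkeystate i h
    exact ⟨_, hbd k hk, (hζ k hk).symm ▸ hHk⟩
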